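/- For all n ≥ 3, the expected number of long braid moves in a uniformly random reduced word for the longest element w₀ ∈ S_n is exactly 1. Equivalently: the number of pairs (ρ, k), where ρ = i₁⋯i_ℓ is a reduced word for w₀ and k ∈ {1,…,ℓ−2} is a position with (i_k, i_{k+1}, i_{k+2}) of the form (i, i+1, i) or (i+1, i, i+1) for some i, equals the number of reduced words for w₀. -/

import Mathlib

open scoped Classical


/-- The adjacent transposition `sᵢ ∈ S_n` swapping `i` and `i+1` (one-based),
for `i ∈ {1, …, n-1}`; junk value `1` otherwise. -/
def simpleRefl (n i : ℕ) : Equiv.Perm (Fin n) :=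
  if h : 1 ≤ i ∧ i < n then Equiv.swap ⟨i - 1, by omega⟩ ⟨i, h.2⟩ else 1

/-- The product `s_{i₁} ⋯ s_{i_m}` of the word `i₁ ⋯ i_m`. -/
def wordProd (n : ℕ) (l : List ℕ) : Equiv.Perm (Fin n) :=
  (l.map (simpleRefl n)).prod

/-- `l` is a word for `w`: letters in `{1, …, n-1}` and product `w`. -/
def IsWordFor (n : ℕ) (w : Equiv.Perm (Fin n)) (l : List ℕ) : Prop :=
  (∀ i ∈ l, 1 ≤ i ∧ i ≤ n - 1) ∧ wordProd n l = w

/-- `l` is a reduced word for `w`: a word for `w` of minimal length. -/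
def IsReducedWordFor (n : ℕ) (w : Equiv.Perm (Fin n)) (l : List ℕ) : Prop :=
  IsWordFor n w l ∧ ∀ l', IsWordFor n w l' → l.length ≤ l'.length

/-- The longest element `w₀ ∈ S_n`, `w₀(i) = n + 1 - i` in one-line notation. -/
def w₀ (n : ℕ) : Equiv.Perm (Fin n) := Fin.revPerm

/-- The number of positions of the word `l` supporting a commutation,
i.e. positions `k` with `|i_k - i_{k+1}| > 1`. -/
def commCount (l : List ℕ) : ℕ :=
  ((Finset.range (l.length - 1)).filter
    (fun k => 1 < |(l.getD k 0 : ℤ) - (l.getD (k+1) 0 : ℤ)|)).card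

/-- The number of consecutive noncommuting pairs in the word `l`,
i.e. positions `k` with `|i_k - i_{k+1}| = 1`. -/
def noncommCount (l : List ℕ) : ℕ :=
  ((Finset.range (l.length - 1)).filter
    (fun k => |(l.getD k 0 : ℤ) - (l.getD (k+1) 0 : ℤ)| = 1)).card

/-- The number of positions of `l` supporting a long braid move, i.e. positions `k`
with `(i_k, i_{k+1}, i_{k+2})` of the form `(i, i+1, i)` or `(i+1, i, i+1)`. -/
noncomputable def braidCount (l : List ℕ) : ℕ :=
  ((Finset.range (l.length - 2)).filter
    (fun k => ∃ i : ℕ,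
      (l.getD k 0, l.getD (k+1) 0, l.getD (k+2) 0) = (i, i+1, i) ∨
      (l.getD k 0, l.getD (k+1) 0, l.getD (k+2) 0) = (i+1, i, i+1))).card

/-- The one-line notation of `v`, as a sequence indexed by the naturals. -/
def entry {n : ℕ} (v : Equiv.Perm (Fin n)) (k : ℕ) : ℕ :=
  if h : k < n then (v ⟨k, h⟩ : ℕ) else k

/-- The product of `g (v p) (v q)` over all pairs of positions `p < q`. -/
@[to_additive]
def pairProd {M : Type*} [CommMonoid M] {n : ℕ} (g : ℕ → ℕ → M) (v : Equiv.Perm (Fin n)) : M :=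
  ∏ x ∈ Finset.univ.filter (fun x : Fin n × Fin n => x.1 < x.2), g (v x.1) (v x.2)

theorem swap_lt_swap_of_succ {n : ℕ} {p q a b : Fin n} (hpq : (q : ℕ) = p + 1) (hab : a < b)
    (hne : (a, b) ≠ (p, q)) : Equiv.swap p q a < Equiv.swap p q b := by
  have hne' : ¬ (a = p ∧ b = q) := by simpa using hne
  simp only [Equiv.swap_apply_def]
  simp only [Fin.ext_iff, Fin.lt_def] at *
  split_ifs <;> omega

@[to_additive]
theorem pairProd_mul_swap {M : Type*} [CommMonoid M] {n : ℕ} (g : ℕ → ℕ → M)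
    (v : Equiv.Perm (Fin n)) {p q : Fin n} (hpq : (q : ℕ) = p + 1) :
    pairProd g (v * Equiv.swap p q) * g (v p) (v q) = pairProd g v * g (v q) (v p) := by
  have hlt : p < q := by rw [Fin.lt_def]; omega
  have hmem : (p, q) ∈ Finset.univ.filter (fun x : Fin n × Fin n => x.1 < x.2) := by simpa
  unfold pairProd
  rw [← Finset.mul_prod_erase _ _ hmem, ← Finset.mul_prod_erase _ (fun x => g (v x.1) (v x.2)) hmem]
  have key : ∏ x ∈ (Finset.univ.filter (fun x : Fin n × Fin n => x.1 < x.2)).erase (p, q),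
        g ((v * Equiv.swap p q) x.1) ((v * Equiv.swap p q) x.2) =
      ∏ x ∈ (Finset.univ.filter (fun x : Fin n × Fin n => x.1 < x.2)).erase (p, q),
        g (v x.1) (v x.2) := by
    have hmaps : ∀ x ∈ (Finset.univ.filter (fun x : Fin n × Fin n => x.1 < x.2)).erase (p, q),
        (Equiv.swap p q x.1, Equiv.swap p q x.2) ∈
          (Finset.univ.filter (fun x : Fin n × Fin n => x.1 < x.2)).erase (p, q) := by
      rintro ⟨a, b⟩ hx
      simp only [Finset.mem_erase, Finset.mem_filter, Finset.mem_univ, true_and] at hx ⊢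
      refine ⟨fun h => ?_, swap_lt_swap_of_succ hpq hx.2 hx.1⟩
      rw [Prod.mk.injEq, Equiv.swap_apply_eq_iff, Equiv.swap_apply_eq_iff,
        Equiv.swap_apply_left, Equiv.swap_apply_right] at h
      obtain ⟨rfl, rfl⟩ := h
      exact absurd hx.2 (not_lt.mpr hlt.le)
    refine Finset.prod_nbij' (fun x => (Equiv.swap p q x.1, Equiv.swap p q x.2))
      (fun x => (Equiv.swap p q x.1, Equiv.swap p q x.2)) hmaps hmaps ?_ ?_ ?_ <;>
      simp
  rw [key]
  simp only [Equiv.Perm.mul_apply, Equiv.swap_apply_left, Equiv.swap_apply_right]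
  simp only [mul_comm, mul_left_comm]

/-- The number of noninversions of `v`. -/
def noninv {n : ℕ} (v : Equiv.Perm (Fin n)) : ℕ :=
  pairSum (fun a b => if a < b then 1 else 0) v

/-- The product of the differences of entries over the noninversions of `v`. -/
def noninvProd {n : ℕ} (v : Equiv.Perm (Fin n)) : ℚ :=
  pairProd (fun a b => if a < b then (b : ℚ) - a else 1) v

theorem simpleRefl_eq {n i : ℕ} (h : 1 ≤ i ∧ i < n) :
    simpleRefl n i = Equiv.swap ⟨i - 1, by omega⟩ ⟨i, h.2⟩ := by
  simp [simpleRefl, h]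

theorem simpleRefl_mul_self (n i : ℕ) : simpleRefl n i * simpleRefl n i = 1 := by
  unfold simpleRefl
  split_ifs <;> simp

theorem entry_ne {n i : ℕ} (h : 1 ≤ i ∧ i < n) (v : Equiv.Perm (Fin n)) :
    entry v (i - 1) ≠ entry v i := by
  have h1 : i - 1 < n := by omega
  simp only [entry, h1, h.2, dif_pos, ne_eq, Fin.val_inj, EmbeddingLike.apply_eq_iff_eq,
    Fin.mk.injEq]
  omega

theorem noninv_mul_simpleRefl {n i : ℕ} (h : 1 ≤ i ∧ i < n) (v : Equiv.Perm (Fin n)) :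
    (entry v (i - 1) < entry v i ∧ noninv (v * simpleRefl n i) + 1 = noninv v) ∨
    (entry v i < entry v (i - 1) ∧ noninv (v * simpleRefl n i) = noninv v + 1) := by
  have h1 : i - 1 < n := by omega
  have key := pairSum_add_swap (fun a b : ℕ => if a < b then 1 else 0) v
    (p := ⟨i - 1, h1⟩) (q := ⟨i, h.2⟩) (by simp; omega)
  rw [← simpleRefl_eq h] at key
  have hne := entry_ne h v
  simp only [entry, h1, h.2, dif_pos] at hne ⊢
  unfold noninv
  rcases lt_or_gt_of_ne hne with hlt | hlt
  · left
    rw [if_pos hlt, if_neg hlt.not_gt] at key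
    exact ⟨hlt, by simpa using key⟩
  · right
    rw [if_pos hlt, if_neg hlt.not_gt] at key
    exact ⟨hlt, by simpa using key⟩

theorem noninvProd_mul_simpleRefl {n i : ℕ} (h : 1 ≤ i ∧ i < n) (v : Equiv.Perm (Fin n))
    (hlt : entry v (i - 1) < entry v i) :
    noninvProd (v * simpleRefl n i) * ((entry v i : ℚ) - entry v (i - 1)) = noninvProd v := by
  have h1 : i - 1 < n := by omega
  have key := pairProd_mul_swap (fun a b : ℕ => if a < b then (b : ℚ) - a else 1) v
    (p := ⟨i - 1, h1⟩) (q := ⟨i, h.2⟩) (by simp; omega)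
  rw [← simpleRefl_eq h] at key
  simp only [entry, h1, h.2, dif_pos] at hlt ⊢
  rw [if_pos hlt, if_neg hlt.not_gt, mul_one] at key
  exact key

theorem noninvProd_ne_zero {n : ℕ} (v : Equiv.Perm (Fin n)) : noninvProd v ≠ 0 := by
  unfold noninvProd pairProd
  refine Finset.prod_ne_zero_iff.mpr fun x _ => ?_
  dsimp only
  split_ifs with h
  · exact sub_ne_zero.mpr (by exact_mod_cast h.ne')
  · exact one_ne_zero

theorem noninv_w₀ (n : ℕ) : noninv (w₀ n) = 0 := by
  unfold noninv pairSum
  refine Finset.sum_eq_zero fun x hx => ?_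
  simp only [Finset.mem_filter, Finset.mem_univ, true_and] at hx
  simp only [w₀, Fin.revPerm_apply]
  rw [if_neg]
  rw [not_lt, ← Fin.le_def, Fin.rev_le_rev]
  exact hx.le

theorem noninv_one (n : ℕ) : noninv (1 : Equiv.Perm (Fin n)) = ∑ k ∈ Finset.range n, (n - 1 - k) := by
  unfold noninv pairSum
  rw [Finset.sum_congr rfl (g := fun _ => 1)]
  · rw [← Finset.card_eq_sum_ones, Finset.card_filter, Fintype.sum_prod_type,
      Finset.sum_range fun k => n - 1 - k]
    refine Finset.sum_congr rfl fun p _ => ?_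
    rw [← Finset.card_filter, ← Fin.card_Ioi]
    congr 1
    ext q
    simp
  · intro x hx
    simpa using hx

theorem noninv_le_length {n : ℕ} (l : List ℕ) (hl : ∀ i ∈ l, 1 ≤ i ∧ i ≤ n - 1)
    (v : Equiv.Perm (Fin n)) (h : v * wordProd n l = w₀ n) : noninv v ≤ l.length := by
  induction l generalizing v with
  | nil =>
    simp only [wordProd, List.map_nil, List.prod_nil, mul_one] at h
    simp [h, noninv_w₀]
  | cons i l ih =>
    have hi := hl i (by simp)
    have := ih (fun j hj => hl j (by simp [hj])) (v * simpleRefl n i)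
      (by rw [← h]; simp [wordProd, mul_assoc])
    have := noninv_mul_simpleRefl (n := n) (i := i) (by omega) v
    simp only [List.length_cons]
    omega

theorem eq_w₀_of_antitone {n : ℕ} (v : Equiv.Perm (Fin n))
    (h : ∀ i, 1 ≤ i ∧ i < n → entry v i < entry v (i - 1)) : v = w₀ n := by
  have hanti : StrictAnti v := by
    cases n with
    | zero => exact fun a => a.elim0
    | succ n =>
      refine Fin.strictAnti_iff_succ_lt.mpr fun i => ?_
      have := h (i + 1) (by omega)
      have h1 : (i : ℕ) < n + 1 := by omega
      have h2 : (i : ℕ) + 1 < n + 1 := by omega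
      simp only [entry, h1, h2, dif_pos, Nat.add_sub_cancel] at this
      exact this
  have hmono : StrictMono (v.trans Fin.revPerm) := fun a b hab => by
    simpa using hanti hab
  have hid : (v.trans Fin.revPerm : Fin n → Fin n) = id :=
    (StrictMono.range_inj hmono strictMono_id).1 (by simp)
  refine Equiv.ext fun a => ?_
  exact Fin.rev_eq_iff.mp (congrFun hid a)

theorem exists_word_to_w₀ {n : ℕ} (v : Equiv.Perm (Fin n)) :
    ∃ l : List ℕ, (∀ i ∈ l, 1 ≤ i ∧ i ≤ n - 1) ∧ v * wordProd n l = w₀ n ∧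
      l.length = noninv v := by
  induction hm : noninv v generalizing v with
  | zero =>
    refine ⟨[], by simp, ?_, by simp⟩
    simp only [wordProd, List.map_nil, List.prod_nil, mul_one]
    refine eq_w₀_of_antitone v fun i hi => ?_
    have := noninv_mul_simpleRefl hi v
    omega
  | succ m ih =>
    have : ∃ i, (1 ≤ i ∧ i < n) ∧ entry v (i - 1) < entry v i := by
      by_contra! hcon
      have := eq_w₀_of_antitone v fun i hi => (hcon i hi).lt_of_ne (entry_ne hi v).symm
      rw [this, noninv_w₀] at hm
      omega
    obtain ⟨i, hi, hlt⟩ := this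
    have := noninv_mul_simpleRefl hi v
    obtain ⟨l, h1, h2, h3⟩ := ih (v * simpleRefl n i) (by omega)
    refine ⟨i :: l, ?_, ?_, by simp [h3]⟩
    · simp only [List.mem_cons, forall_eq_or_imp]
      exact ⟨by omega, h1⟩
    · rw [← h2]
      simp [wordProd, mul_assoc]

theorem entry_mul_simpleRefl {n k : ℕ} (hk : k + 1 < n) (v : Equiv.Perm (Fin n)) (j : ℕ) :
    entry (v * simpleRefl n (k + 1)) j = entry v (Equiv.swap k (k + 1) j) := by
  rw [simpleRefl_eq ⟨by omega, hk⟩]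
  by_cases hj : j < n
  · simp only [entry, hj, dif_pos, Equiv.Perm.mul_apply, Equiv.swap_apply_def, Fin.ext_iff,
      Nat.add_sub_cancel]
    split_ifs <;> first | rfl | omega
  · have h1 : j ≠ k := by omega
    have h2 : j ≠ k + 1 := by omega
    simp [entry, hj, Equiv.swap_apply_of_ne_of_ne h1 h2]

/-- The `i`-th divided difference operator on functions on `S_n`, where the `k`-th variable is
the function `v ↦ v k`. -/
def divDiff (n i : ℕ) : (Equiv.Perm (Fin n) → ℚ) →ₗ[ℚ] (Equiv.Perm (Fin n) → ℚ) where
  toFun f v := (f v - f (v * simpleRefl n i)) / ((entry v (i - 1) : ℚ) - entry v i)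
  map_add' f g := by
    funext v
    simp only [Pi.add_apply]
    ring
  map_smul' c f := by
    funext v
    simp only [Pi.smul_apply, smul_eq_mul, RingHom.id_apply]
    ring

theorem divDiff_apply (n i : ℕ) (f : Equiv.Perm (Fin n) → ℚ) (v : Equiv.Perm (Fin n)) :
    divDiff n i f v = (f v - f (v * simpleRefl n i)) / ((entry v (i - 1) : ℚ) - entry v i) :=
  rfl

/-- The composition of divided difference operators along a word. -/
def divDiffWord (n : ℕ) (l : List ℕ) : Module.End ℚ (Equiv.Perm (Fin n) → ℚ) :=
  (l.map (divDiff n)).prod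

theorem divDiffWord_cons (n i : ℕ) (l : List ℕ) (f : Equiv.Perm (Fin n) → ℚ) :
    divDiffWord n (i :: l) f = divDiff n i (divDiffWord n l f) := by
  simp [divDiffWord]

theorem divDiffWord_append (n : ℕ) (l l' : List ℕ) (f : Equiv.Perm (Fin n) → ℚ) :
    divDiffWord n (l ++ l') f = divDiffWord n l (divDiffWord n l' f) := by
  simp [divDiffWord]

theorem divDiffWord_single_w₀ {n : ℕ} (l : List ℕ) (hl : ∀ i ∈ l, 1 ≤ i ∧ i ≤ n - 1)
    (v : Equiv.Perm (Fin n)) (h : l.length ≤ noninv v) :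
    divDiffWord n l (Pi.single (w₀ n) 1) v =
      if v * wordProd n l = w₀ n then (noninvProd v)⁻¹ else 0 := by
  induction l generalizing v with
  | nil =>
    simp only [divDiffWord, wordProd, List.map_nil, List.prod_nil, mul_one, Module.End.one_apply,
      Pi.single_apply]
    split_ifs with hv
    · have hone : noninvProd v = 1 := by
        subst hv
        unfold noninvProd pairProd
        refine Finset.prod_eq_one fun x hx => ?_
        simp only [Finset.mem_filter, Finset.mem_univ, true_and] at hx
        have : ¬ ((w₀ n x.1 : ℕ) < w₀ n x.2) := by
          simp only [w₀, Fin.revPerm_apply, Fin.val_fin_lt, Fin.rev_lt_rev]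
          exact hx.not_gt
        simp [this]
      simp [hone]
    · rfl
  | cons i l ih =>
    have hi := hl i (by simp)
    have hl' : ∀ j ∈ l, 1 ≤ j ∧ j ≤ n - 1 := fun j hj => hl j (by simp [hj])
    have hin : 1 ≤ i ∧ i < n := by omega
    have hprod : v * wordProd n (i :: l) = v * simpleRefl n i * wordProd n l := by
      simp [wordProd, mul_assoc]
    simp only [List.length_cons] at h
    have h0 : divDiffWord n l (Pi.single (w₀ n) 1) v = 0 := by
      rw [ih hl' v (by omega), if_neg]
      intro hv
      have := noninv_le_length l hl' v hv
      omega
    rw [divDiffWord_cons, divDiff_apply, h0, hprod]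
    rcases noninv_mul_simpleRefl hin v with ⟨hlt, hn⟩ | ⟨hlt, hn⟩
    · rw [ih hl' _ (by omega)]
      split_ifs with hv
      · rw [← noninvProd_mul_simpleRefl hin v hlt]
        have h1 : (entry v i : ℚ) - entry v (i - 1) ≠ 0 :=
          sub_ne_zero.mpr (by exact_mod_cast hlt.ne')
        have h2 : (entry v (i - 1) : ℚ) - entry v i ≠ 0 :=
          sub_ne_zero.mpr (by exact_mod_cast hlt.ne)
        have h3 := noninvProd_ne_zero (v * simpleRefl n i)
        field_simp
        ring
      · simp
    · have hv : ¬ (v * simpleRefl n i * wordProd n l = w₀ n) := by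
        intro hv
        have := noninv_le_length l hl' _ hv
        omega
      rw [ih hl' _ (by omega), if_neg hv, if_neg hv]
      simp

/-- The monomial function `v ↦ ∏ k, (v k) ^ α k`. -/
def mono (n : ℕ) (α : ℕ → ℕ) (v : Equiv.Perm (Fin n)) : ℚ :=
  ∏ k ∈ Finset.range n, (entry v k : ℚ) ^ α k

/-- The sequence `α` with the entries at `k` and `k + 1` replaced by `p` and `q`. -/
def setPair {M : Type*} (α : ℕ → M) (k : ℕ) (p q : M) : ℕ → M :=
  Function.update (Function.update α k p) (k + 1) q

theorem setPair_self {M : Type*} (α : ℕ → M) (k : ℕ) : setPair α k (α k) (α (k + 1)) = α := by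
  simp [setPair]

theorem setPair_left {M : Type*} (α : ℕ → M) (k : ℕ) (p q : M) : setPair α k p q k = p := by
  simp [setPair]

theorem setPair_right {M : Type*} (α : ℕ → M) (k : ℕ) (p q : M) :
    setPair α k p q (k + 1) = q := by
  simp [setPair]

theorem setPair_of_ne {M : Type*} (α : ℕ → M) {k j : ℕ} (p q : M) (h : j ≠ k)
    (h' : j ≠ k + 1) : setPair α k p q j = α j := by
  simp [setPair, h, h']

theorem range_eq_insert_pair {n k : ℕ} (hk : k + 1 < n) : Finset.range n =
    insert k (insert (k + 1) (((Finset.range n).erase k).erase (k + 1))) := by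
  ext j
  simp only [Finset.mem_range, Finset.mem_insert, Finset.mem_erase]
  omega

@[to_additive]
theorem prod_range_pair {M : Type*} [CommMonoid M] {n k : ℕ} (hk : k + 1 < n) (f : ℕ → M) :
    ∏ j ∈ Finset.range n, f j =
      f k * f (k + 1) * ∏ j ∈ ((Finset.range n).erase k).erase (k + 1), f j := by
  rw [range_eq_insert_pair hk, Finset.prod_insert (by simp), Finset.prod_insert (by simp),
    mul_assoc, ← range_eq_insert_pair hk]

theorem mono_setPair {n k : ℕ} (hk : k + 1 < n) (α : ℕ → ℕ) (p q : ℕ) (v : Equiv.Perm (Fin n)) :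
    mono n (setPair α k p q) v = (entry v k : ℚ) ^ p * (entry v (k + 1) : ℚ) ^ q *
      ∏ j ∈ ((Finset.range n).erase k).erase (k + 1), (entry v j : ℚ) ^ α j := by
  unfold mono
  rw [prod_range_pair hk, setPair_left, setPair_right]
  congr 1
  refine Finset.prod_congr rfl fun j hj => ?_
  simp only [Finset.mem_erase] at hj
  rw [setPair_of_ne _ _ _ hj.2.1 hj.1]

theorem mono_setPair_mul_simpleRefl {n k : ℕ} (hk : k + 1 < n) (α : ℕ → ℕ) (p q : ℕ)
    (v : Equiv.Perm (Fin n)) :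
    mono n (setPair α k p q) (v * simpleRefl n (k + 1)) = mono n (setPair α k q p) v := by
  rw [mono_setPair hk, mono_setPair hk, entry_mul_simpleRefl hk, entry_mul_simpleRefl hk,
    Equiv.swap_apply_left, Equiv.swap_apply_right, mul_comm ((entry v (k + 1) : ℚ) ^ p)]
  congr 1
  refine Finset.prod_congr rfl fun j hj => ?_
  simp only [Finset.mem_erase] at hj
  rw [entry_mul_simpleRefl hk, Equiv.swap_apply_of_ne_of_ne hj.2.1 hj.1]

theorem divDiff_mono_swap {n k : ℕ} (hk : k + 1 < n) (α : ℕ → ℕ) (p q : ℕ) :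
    divDiff n (k + 1) (mono n (setPair α k p q)) =
      - divDiff n (k + 1) (mono n (setPair α k q p)) := by
  funext v
  rw [Pi.neg_apply, divDiff_apply, divDiff_apply, mono_setPair_mul_simpleRefl hk,
    mono_setPair_mul_simpleRefl hk]
  ring

theorem divDiff_mono {n k : ℕ} (hk : k + 1 < n) (α : ℕ → ℕ) (b d : ℕ) :
    divDiff n (k + 1) (mono n (setPair α k (b + d) b)) =
      ∑ t ∈ Finset.range d, mono n (setPair α k (b + t) (b + (d - 1 - t))) := by
  funext v
  have hne : (entry v k : ℚ) - entry v (k + 1) ≠ 0 := by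
    have := entry_ne (i := k + 1) ⟨by omega, hk⟩ v
    exact sub_ne_zero.mpr (by exact_mod_cast this)
  rw [divDiff_apply, mono_setPair_mul_simpleRefl hk, Nat.add_sub_cancel, div_eq_iff hne,
    Finset.sum_apply]
  simp only [mono_setPair hk]
  have key := (Commute.all (entry v k : ℚ) (entry v (k + 1))).geom_sum₂_mul d
  rw [← Finset.sum_mul, ← sub_mul, mul_right_comm]
  congr 1
  calc _ = ((entry v k : ℚ) * entry v (k + 1)) ^ b *
        ((entry v k : ℚ) ^ d - (entry v (k + 1) : ℚ) ^ d) := by ring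
    _ = _ := by
      rw [← key, ← mul_assoc, Finset.mul_sum]
      congr 1
      refine Finset.sum_congr rfl fun t _ => ?_
      rw [pow_add, pow_add, mul_pow]
      ring

/-- The sum of all divided difference operators. -/
def divDiffSum (n : ℕ) : Module.End ℚ (Equiv.Perm (Fin n) → ℚ) :=
  ∑ k ∈ Finset.range (n - 1), divDiff n (k + 1)

/-- The span of the monomials of degree less than `m`. -/
def degreeLT (n m : ℕ) : Submodule ℚ (Equiv.Perm (Fin n) → ℚ) :=
  Submodule.span ℚ {f | ∃ α : ℕ → ℕ, ∑ k ∈ Finset.range n, α k < m ∧ f = mono n α}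

theorem mono_mem_degreeLT {n m : ℕ} {α : ℕ → ℕ} (h : ∑ k ∈ Finset.range n, α k < m) :
    mono n α ∈ degreeLT n m :=
  Submodule.subset_span ⟨α, h, rfl⟩

theorem degreeLT_mono {n m m' : ℕ} (h : m ≤ m') : degreeLT n m ≤ degreeLT n m' :=
  Submodule.span_mono fun _ ⟨α, hα, hf⟩ => ⟨α, hα.trans_le h, hf⟩

theorem degreeLT_zero (n : ℕ) : degreeLT n 0 = ⊥ := by
  simp [degreeLT]

theorem sum_setPair {n k : ℕ} (hk : k + 1 < n) (α : ℕ → ℕ) (p q : ℕ) :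
    ∑ j ∈ Finset.range n, setPair α k p q j + (α k + α (k + 1)) =
      p + q + ∑ j ∈ Finset.range n, α j := by
  rw [sum_range_pair hk, sum_range_pair hk α, setPair_left, setPair_right]
  have : ∑ j ∈ ((Finset.range n).erase k).erase (k + 1), setPair α k p q j =
      ∑ j ∈ ((Finset.range n).erase k).erase (k + 1), α j :=
    Finset.sum_congr rfl fun j hj => by
      simp only [Finset.mem_erase] at hj
      rw [setPair_of_ne _ _ _ hj.2.1 hj.1]
  omega

theorem divDiff_setPair_mem_degreeLT {n k m : ℕ} (hk : k + 1 < n) (α : ℕ → ℕ) (b d : ℕ)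
    (h : ∑ j ∈ Finset.range n, setPair α k (b + d) b j < m) :
    divDiff n (k + 1) (mono n (setPair α k (b + d) b)) ∈ degreeLT n (m - 1) := by
  rw [divDiff_mono hk]
  refine Submodule.sum_mem _ fun t ht => mono_mem_degreeLT ?_
  have h1 := sum_setPair hk α (b + d) b
  have h2 := sum_setPair hk α (b + t) (b + (d - 1 - t))
  have := Finset.mem_range.mp ht
  omega

theorem divDiff_mem_degreeLT {n k m : ℕ} (hk : k + 1 < n) {f : Equiv.Perm (Fin n) → ℚ}
    (hf : f ∈ degreeLT n m) : divDiff n (k + 1) f ∈ degreeLT n (m - 1) := by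
  suffices h : degreeLT n m ≤ (degreeLT n (m - 1)).comap (divDiff n (k + 1)) from h hf
  refine Submodule.span_le.mpr ?_
  rintro _ ⟨α, hα, rfl⟩
  change divDiff n (k + 1) (mono n α) ∈ degreeLT n (m - 1)
  rcases le_total (α (k + 1)) (α k) with h | h
  · obtain ⟨d, hd⟩ := Nat.exists_eq_add_of_le h
    rw [← setPair_self α k, hd] at hα ⊢
    exact divDiff_setPair_mem_degreeLT hk α _ d hα
  · obtain ⟨d, hd⟩ := Nat.exists_eq_add_of_le h
    rw [← setPair_self α k, hd, divDiff_mono_swap hk]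
    refine Submodule.neg_mem _ (divDiff_setPair_mem_degreeLT hk α _ d ?_)
    have := sum_setPair hk α (α k + d) (α k)
    omega

theorem divDiffWord_mem_degreeLT {n m : ℕ} (l : List ℕ) (hl : ∀ i ∈ l, 1 ≤ i ∧ i ≤ n - 1)
    {f : Equiv.Perm (Fin n) → ℚ} (hf : f ∈ degreeLT n m) :
    divDiffWord n l f ∈ degreeLT n (m - l.length) := by
  induction l with
  | nil => simpa [divDiffWord] using hf
  | cons i l ih =>
    have hi := hl i (by simp)
    obtain ⟨k, rfl⟩ : ∃ k, i = k + 1 := ⟨i - 1, by omega⟩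
    rw [divDiffWord_cons, List.length_cons, ← Nat.sub_sub]
    exact divDiff_mem_degreeLT (by omega) (ih fun j hj => hl j (by simp [hj]))

theorem mono_add_single {n k : ℕ} (hk : k < n) (α : ℕ → ℕ) (v : Equiv.Perm (Fin n)) :
    mono n (α + Pi.single k 1) v = entry v k * mono n α v := by
  have hmem := Finset.mem_range.mpr hk
  unfold mono
  rw [← Finset.mul_prod_erase _ _ hmem, ← Finset.mul_prod_erase _ (fun j => _ ^ α j) hmem,
    ← mul_assoc]
  congr 1
  · simp only [Pi.add_apply, Pi.single_eq_same, pow_succ']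
  · refine Finset.prod_congr rfl fun j hj => ?_
    simp [Finset.ne_of_mem_erase hj]

theorem sum_add_single {n k : ℕ} (hk : k < n) (α : ℕ → ℕ) :
    ∑ j ∈ Finset.range n, (α + Pi.single k 1 : ℕ → ℕ) j = ∑ j ∈ Finset.range n, α j + 1 := by
  simp [Finset.sum_add_distrib, hk, Pi.single_apply]

theorem mul_mem_degreeLT {n k m : ℕ} (hk : k < n) {f : Equiv.Perm (Fin n) → ℚ}
    (hf : f ∈ degreeLT n m) : (fun v => (entry v k : ℚ) * f v) ∈ degreeLT n (m + 1) := by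
  induction hf using Submodule.span_induction with
  | mem f hf =>
    obtain ⟨α, hα, rfl⟩ := hf
    have : (fun v => (entry v k : ℚ) * mono n α v) = mono n (α + Pi.single k 1) :=
      funext fun v => (mono_add_single hk α v).symm
    rw [this]
    refine mono_mem_degreeLT ?_
    rw [sum_add_single hk]
    omega
  | zero => simp only [Pi.zero_apply, mul_zero]; exact Submodule.zero_mem _
  | add f g _ _ hf hg =>
    simp only [Pi.add_apply, mul_add]
    exact Submodule.add_mem _ hf hg
  | smul c f _ hf =>
    simp only [Pi.smul_apply, smul_eq_mul, mul_left_comm _ c]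
    exact Submodule.smul_mem _ c hf

/-- The product of falling factorials with the same leading term as `mono n α`. -/
def fallingMono (n : ℕ) (α : ℕ → ℕ) (v : Equiv.Perm (Fin n)) : ℚ :=
  ∏ k ∈ Finset.range n, ∏ c ∈ Finset.range (α k), ((entry v k : ℚ) - c)

theorem fallingMono_add_single {n k : ℕ} (hk : k < n) (α : ℕ → ℕ) (v : Equiv.Perm (Fin n)) :
    fallingMono n (α + Pi.single k 1) v = (entry v k - α k) * fallingMono n α v := by
  have hmem := Finset.mem_range.mpr hk
  unfold fallingMono
  rw [← Finset.mul_prod_erase _ _ hmem,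
    ← Finset.mul_prod_erase _ (fun j => ∏ c ∈ Finset.range (α j), _) hmem, ← mul_assoc]
  congr 1
  · simp only [Pi.add_apply, Pi.single_eq_same, Finset.prod_range_succ]
    ring
  · refine Finset.prod_congr rfl fun j hj => ?_
    simp [Finset.ne_of_mem_erase hj]

theorem fallingMono_sub_mono_mem {n m : ℕ} (α : ℕ → ℕ) (h : ∑ k ∈ Finset.range n, α k = m) :
    fallingMono n α - mono n α ∈ degreeLT n m := by
  induction m generalizing α with
  | zero =>
    have h0 : ∀ k ∈ Finset.range n, α k = 0 := by simpa using h
    have h1 : fallingMono n α = mono n α := by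
      funext v
      refine Finset.prod_congr rfl fun k hk => ?_
      simp [h0 k hk]
    rw [h1, sub_self]
    exact Submodule.zero_mem _
  | succ m ih =>
    obtain ⟨k, hk, hne⟩ : ∃ k ∈ Finset.range n, α k ≠ 0 := by
      by_contra! hcon
      rw [Finset.sum_eq_zero hcon] at h
      omega
    have hkn := Finset.mem_range.mp hk
    obtain ⟨β, rfl⟩ : ∃ β : ℕ → ℕ, α = β + Pi.single k 1 := by
      refine ⟨Function.update α k (α k - 1), funext fun j => ?_⟩
      by_cases hj : j = k
      · subst hj
        simp only [Pi.add_apply, Function.update_self, Pi.single_eq_same]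
        omega
      · simp [hj]
    rw [sum_add_single hkn] at h
    have hβ := ih β (by omega)
    have : fallingMono n (β + Pi.single k 1) - mono n (β + Pi.single k 1) =
        (fun v => (entry v k : ℚ) * (fallingMono n β - mono n β) v) -
          ((β k : ℚ) • (fallingMono n β - mono n β) + (β k : ℚ) • mono n β) := by
      funext v
      simp only [Pi.sub_apply, Pi.add_apply, Pi.smul_apply, smul_eq_mul,
        fallingMono_add_single hkn, mono_add_single hkn]
      ring
    rw [this]
    refine Submodule.sub_mem _ (mul_mem_degreeLT hkn hβ) (Submodule.add_mem _
      (Submodule.smul_mem _ _ (degreeLT_mono (by omega) hβ))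
      (Submodule.smul_mem _ _ (mono_mem_degreeLT (by omega))))

/-- The staircase exponent `(n - 1, n - 2, …, 0)`. -/
def staircase (n k : ℕ) : ℕ := n - 1 - k

theorem fallingMono_staircase_ne_zero_iff {n : ℕ} (v : Equiv.Perm (Fin n)) :
    fallingMono n (staircase n) v ≠ 0 ↔ v = w₀ n := by
  have h1 : fallingMono n (staircase n) v ≠ 0 ↔ ∀ p : Fin n, n - 1 - (p : ℕ) ≤ v p := by
    unfold fallingMono staircase
    simp only [Finset.prod_ne_zero_iff, Finset.mem_range, sub_ne_zero, ne_eq, Nat.cast_inj]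
    constructor
    · intro h p
      have := h p p.2
      simp only [entry, p.2, dif_pos, Fin.eta] at this
      by_contra! hlt
      exact this _ hlt rfl
    · intro h k hk c hc
      have := h ⟨k, hk⟩
      simp only [entry, hk, dif_pos]
      simp only at this
      omega
  rw [h1]
  constructor
  · intro h
    have hsum : ∑ p : Fin n, (n - 1 - (p : ℕ)) = ∑ p : Fin n, (v p : ℕ) := by
      rw [Equiv.sum_comp v (fun p => (p : ℕ)), ← Equiv.sum_comp Fin.revPerm (fun p => (p : ℕ))]
      refine Finset.sum_congr rfl fun p _ => ?_
      simp only [Fin.revPerm_apply, Fin.val_rev]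
      omega
    have heq := (Finset.sum_eq_sum_iff_of_le fun p _ => h p).mp hsum
    refine Equiv.ext fun p => Fin.ext ?_
    have := heq p (Finset.mem_univ p)
    simp only [w₀, Fin.revPerm_apply, Fin.val_rev]
    omega
  · rintro rfl p
    simp only [w₀, Fin.revPerm_apply, Fin.val_rev]
    omega

/-- The value of a full divided difference word at the staircase monomial, if nonzero. -/
def topConst (n : ℕ) : ℚ :=
  fallingMono n (staircase n) (w₀ n) * (noninvProd (1 : Equiv.Perm (Fin n)))⁻¹

theorem topConst_ne_zero (n : ℕ) : topConst n ≠ 0 :=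
  mul_ne_zero ((fallingMono_staircase_ne_zero_iff _).mpr rfl)
    (inv_ne_zero (noninvProd_ne_zero _))

theorem divDiffWord_mono_staircase {n : ℕ} (l : List ℕ) (hl : ∀ i ∈ l, 1 ≤ i ∧ i ≤ n - 1)
    (hlen : l.length = ∑ k ∈ Finset.range n, staircase n k) :
    divDiffWord n l (mono n (staircase n)) 1 =
      if wordProd n l = w₀ n then topConst n else 0 := by
  have h1 := divDiffWord_mem_degreeLT l hl (fallingMono_sub_mono_mem (staircase n) rfl)
  rw [hlen, Nat.sub_self, degreeLT_zero, Submodule.mem_bot, map_sub, sub_eq_zero] at h1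
  have h2 : fallingMono n (staircase n) =
      fallingMono n (staircase n) (w₀ n) • Pi.single (w₀ n) 1 := by
    funext v
    by_cases hv : v = w₀ n
    · subst hv
      simp
    · have := not_imp_comm.mp (fallingMono_staircase_ne_zero_iff v).mp hv
      simp [hv, this]
  rw [← h1, h2, map_smul, Pi.smul_apply,
    divDiffWord_single_w₀ l hl 1 (by rw [hlen, noninv_one]; rfl), one_mul, smul_eq_mul]
  simp [topConst]

/-- The reciprocal factorial, extended by zero to the negative integers. -/
def invFact (a : ℤ) : ℚ := if 0 ≤ a then ((a.toNat).factorial : ℚ)⁻¹ else 0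

theorem invFact_of_neg {a : ℤ} (h : a < 0) : invFact a = 0 := by
  simp [invFact, h]

theorem invFact_zero : invFact 0 = 1 := by
  simp [invFact]

theorem mul_invFact (a : ℤ) : (a : ℚ) * invFact a = invFact (a - 1) := by
  rcases lt_trichotomy a 0 with h | rfl | h
  · rw [invFact_of_neg h, invFact_of_neg (by omega), mul_zero]
  · rw [Int.cast_zero, zero_mul, zero_sub, invFact_of_neg neg_one_lt_zero]
  · obtain ⟨m, rfl⟩ : ∃ m : ℕ, a = m + 1 := ⟨(a - 1).toNat, by omega⟩
    have h1 : ((m : ℤ) + 1).toNat = m + 1 := by omega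
    have h2 : (0 : ℤ) ≤ m + 1 := by omega
    simp only [invFact, h1, h2, if_true, add_sub_cancel_right, Int.toNat_natCast, Nat.cast_nonneg,
      Nat.factorial_succ]
    have := Nat.factorial_ne_zero m
    push_cast
    field_simp

/-- The matrix in Aitken's determinantal formula for the number of standard Young tableaux. -/
def aitkenMatrix (n : ℕ) (α : ℕ → ℤ) : Matrix (Fin n) (Fin n) ℚ :=
  Matrix.of fun i j => invFact (α i - (i : ℕ) + (j : ℕ))

/-- Aitken's determinant. -/
def aitken (n : ℕ) (α : ℕ → ℤ) : ℚ := (aitkenMatrix n α).det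

theorem aitken_zero (n : ℕ) {α : ℕ → ℤ} (h : ∀ k < n, α k = 0) : aitken n α = 1 := by
  unfold aitken
  rw [Matrix.det_of_isUpperTriangular]
  · refine Finset.prod_eq_one fun i _ => ?_
    simp [aitkenMatrix, h i i.2, invFact_zero]
  · intro i j hij
    simp only [aitkenMatrix, Matrix.of_apply, h i i.2]
    refine invFact_of_neg ?_
    have : (j : ℕ) < i := hij
    omega

theorem aitken_setPair {n k : ℕ} (hk : k + 1 < n) (α : ℕ → ℤ) (p q : ℤ) :
    aitken n (setPair α k p q) = - aitken n (setPair α k (q - 1) (p + 1)) := by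
  have hk' : k < n := by omega
  have hne : (⟨k, hk'⟩ : Fin n) ≠ ⟨k + 1, hk⟩ := by simp
  have : aitkenMatrix n (setPair α k p q) =
      (aitkenMatrix n (setPair α k (q - 1) (p + 1))).submatrix
        (Equiv.swap ⟨k, hk'⟩ ⟨k + 1, hk⟩) id := by
    ext i j
    simp only [aitkenMatrix, Matrix.of_apply, Matrix.submatrix_apply, id]
    by_cases h1 : i = ⟨k, hk'⟩
    · subst h1
      rw [Equiv.swap_apply_left]
      simp only [setPair_left, setPair_right]
      push_cast
      congr 1
      ring
    · by_cases h2 : i = ⟨k + 1, hk⟩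
      · subst h2
        rw [Equiv.swap_apply_right]
        simp only [setPair_left, setPair_right]
        push_cast
        congr 1
        ring
      · rw [Equiv.swap_apply_of_ne_of_ne h1 h2]
        have h3 : (i : ℕ) ≠ k := fun h => h1 (Fin.ext h)
        have h4 : (i : ℕ) ≠ k + 1 := fun h => h2 (Fin.ext h)
        rw [setPair_of_ne _ _ _ h3 h4, setPair_of_ne _ _ _ h3 h4]
  unfold aitken
  rw [this, Matrix.det_permute, Equiv.Perm.sign_swap hne]
  simp

theorem aitken_eq_zero_of_neg {n k : ℕ} (hk : k < n) {α : ℕ → ℤ} (h : α k + n ≤ k) :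
    aitken n α = 0 := by
  refine Matrix.det_eq_zero_of_row_eq_zero ⟨k, hk⟩ fun j => ?_
  simp only [aitkenMatrix, Matrix.of_apply]
  exact invFact_of_neg (by omega)

theorem aitken_update {n k : ℕ} (hk : k < n) (α : ℕ → ℤ) (a : ℤ) :
    aitkenMatrix n (Function.update α k a) =
      (aitkenMatrix n α).updateRow ⟨k, hk⟩ fun j => invFact (a - k + (j : ℕ)) := by
  ext i j
  by_cases hi : i = ⟨k, hk⟩
  · subst hi
    simp [aitkenMatrix]
  · have : (i : ℕ) ≠ k := fun h => hi (Fin.ext h)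
    simp [aitkenMatrix, hi, this]

theorem sum_aitken_sub_one (n : ℕ) (α : ℕ → ℤ) :
    ∑ k ∈ Finset.range n, aitken n (Function.update α k (α k - 1)) =
      (∑ k ∈ Finset.range n, (α k : ℚ)) * aitken n α := by
  rw [Finset.sum_range, Finset.sum_range (fun k => (α k : ℚ))]
  have h1 : ∀ β : ℕ → ℤ, aitken n β = ∑ σ : Equiv.Perm (Fin n),
      ((Equiv.Perm.sign σ : ℤ) : ℚ) * ∏ i, aitkenMatrix n β i (σ i) := by
    intro β
    unfold aitken
    rw [← Matrix.det_transpose, Matrix.det_apply']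
    rfl
  simp only [h1]
  rw [Finset.sum_comm, Finset.mul_sum]
  refine Finset.sum_congr rfl fun σ _ => ?_
  rw [← Finset.mul_sum, mul_left_comm]
  congr 1
  have h2 : ∀ k : Fin n, ∏ i, aitkenMatrix n (Function.update α k (α k - 1)) i (σ i) =
      ((α k : ℚ) - (k : ℕ) + (σ k : ℕ)) * ∏ i, aitkenMatrix n α i (σ i) := by
    intro k
    rw [← Finset.mul_prod_erase _ _ (Finset.mem_univ k),
      ← Finset.mul_prod_erase _ (fun i => aitkenMatrix n α i (σ i)) (Finset.mem_univ k),
      ← mul_assoc]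
    congr 1
    · have := mul_invFact (α k - (k : ℕ) + (σ k : ℕ))
      push_cast at this
      simp only [aitkenMatrix, Matrix.of_apply, Function.update_self]
      rw [this]
      congr 1
      ring
    · refine Finset.prod_congr rfl fun i hi => ?_
      have : (i : ℕ) ≠ k := fun h => Finset.ne_of_mem_erase hi (Fin.ext h)
      simp [aitkenMatrix, this]
  simp only [h2]
  rw [← Finset.sum_mul]
  congr 1
  rw [Finset.sum_add_distrib, Finset.sum_sub_distrib, Equiv.sum_comp σ (fun k => ((k : ℕ) : ℚ))]
  ring

theorem sum_aitken_setPair {n k : ℕ} (hk : k + 1 < n) (α : ℕ → ℤ) (b : ℤ) (d : ℕ) :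
    ∑ t ∈ Finset.range d, aitken n (setPair α k (b + t) (b + (d - 1 - t : ℕ))) =
      aitken n (setPair α k (b + d - 1) b) := by
  cases d with
  | zero =>
    have := aitken_setPair hk α (b - 1) b
    simp only [sub_add_cancel] at this
    simp only [Finset.range_zero, Finset.sum_empty, Nat.cast_zero, add_zero]
    linarith
  | succ d =>
    rw [Finset.sum_range_succ]
    have hz : ∑ t ∈ Finset.range d, aitken n (setPair α k (b + t) (b + (d + 1 - 1 - t : ℕ))) =
        - ∑ t ∈ Finset.range d, aitken n (setPair α k (b + t) (b + (d + 1 - 1 - t : ℕ))) := by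
      conv_lhs => rw [← Finset.sum_range_reflect]
      rw [← Finset.sum_neg_distrib]
      refine Finset.sum_congr rfl fun t ht => ?_
      have := Finset.mem_range.mp ht
      rw [aitken_setPair hk]
      congr 3 <;> omega
    have hz' : ∑ t ∈ Finset.range d,
        aitken n (setPair α k (b + t) (b + (d + 1 - 1 - t : ℕ))) = 0 := by linarith
    rw [hz', zero_add]
    congr 2 <;> simp
    ring

theorem setPair_natCast (α : ℕ → ℕ) (k p q : ℕ) :
    (fun j => ((setPair α k p q j : ℕ) : ℤ)) = setPair (fun j => (α j : ℤ)) k (p : ℤ) (q : ℤ) := by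
  funext j
  simp only [setPair, Function.update_apply]
  split_ifs <;> rfl

theorem divDiffSum_pow_mono {n m : ℕ} (hn : 1 ≤ n) (α : ℕ → ℕ)
    (hα : ∀ k < n, α k ≤ staircase n k) (hdeg : ∑ k ∈ Finset.range n, α k = m) :
    (divDiffSum n ^ m) (mono n α) = fun _ => (m.factorial : ℚ) * aitken n (fun k => α k) := by
  induction m generalizing α with
  | zero =>
    have h0 : ∀ k ∈ Finset.range n, α k = 0 := by simpa using hdeg
    funext v
    rw [aitken_zero n fun k hk => by simp [h0 k (Finset.mem_range.mpr hk)]]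
    simp only [pow_zero, Module.End.one_apply, Nat.factorial_zero, Nat.cast_one, mul_one]
    exact Finset.prod_eq_one fun k hk => by simp [h0 k hk]
  | succ m ih =>
    have hge : ∀ k, k + 1 < n → ∀ b d,
        (∀ j < n, setPair α k (b + d) b j ≤ staircase n j ∨
          setPair α k b (b + d) j ≤ staircase n j) → b + d ≤ staircase n k →
        ∑ j ∈ Finset.range n, setPair α k (b + d) b j = m + 1 →
        (divDiffSum n ^ m) (divDiff n (k + 1) (mono n (setPair α k (b + d) b))) =
          fun _ => (m.factorial : ℚ) *
            aitken n (setPair (fun j => (α j : ℤ)) k ((b : ℤ) + d - 1) b) := by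
      intro k hk b d hst hbd hsum
      rw [divDiff_mono hk, map_sum, ← sum_aitken_setPair hk, Finset.mul_sum]
      funext v
      rw [Finset.sum_apply]
      refine Finset.sum_congr rfl fun t ht => ?_
      have htd := Finset.mem_range.mp ht
      rw [ih, setPair_natCast]
      · push_cast
        rfl
      · intro j hj
        unfold staircase at *
        by_cases h1 : j = k
        · subst h1
          rw [setPair_left]
          omega
        · by_cases h2 : j = k + 1
          · subst h2
            rw [setPair_right]
            omega
          · have := hst j hj
            rw [setPair_of_ne _ _ _ h1 h2] at *
            rw [setPair_of_ne _ _ _ h1 h2] at this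
            omega
      · have h1 := sum_setPair hk α (b + d) b
        have h2 := sum_setPair hk α (b + t) (b + (d - 1 - t))
        omega
    have hdiff : ∀ k, k + 1 < n → (divDiffSum n ^ m) (divDiff n (k + 1) (mono n α)) =
        fun _ => (m.factorial : ℚ) *
          aitken n (Function.update (fun j => (α j : ℤ)) k ((α k : ℤ) - 1)) := by
      intro k hk
      have hupd : Function.update (fun j => (α j : ℤ)) k ((α k : ℤ) - 1) =
          setPair (fun j => (α j : ℤ)) k ((α k : ℤ) - 1) (α (k + 1)) := by
        funext j
        simp only [setPair, Function.update_apply]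
        split_ifs <;> simp_all
      rw [hupd]
      have hk0 := hα k (by omega)
      have hk1 := hα (k + 1) hk
      unfold staircase at hk1
      rcases le_total (α (k + 1)) (α k) with h | h
      · obtain ⟨d, hd⟩ := Nat.exists_eq_add_of_le h
        have hα' : setPair α k (α (k + 1) + d) (α (k + 1)) = α := by
          rw [← hd, setPair_self]
        have := hge k hk (α (k + 1)) d (fun j hj => Or.inl (by rw [hα']; exact hα j hj))
          (by omega) (by rw [hα', hdeg])
        rw [hα'] at this
        rw [this, hd]
        push_cast
        rfl
      · obtain ⟨d, hd⟩ := Nat.exists_eq_add_of_le h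
        have hα' : setPair α k (α k) (α k + d) = α := by
          rw [← hd, setPair_self]
        have := hge k hk (α k) d (fun j hj => Or.inr (by rw [hα']; exact hα j hj))
          (by unfold staircase at *; omega)
          (by have := sum_setPair hk α (α k + d) (α k); omega)
        rw [← hα', divDiff_mono_swap hk, map_neg, this, hα', hd, aitken_setPair hk]
        funext v
        simp
    have hlast : aitken n (Function.update (fun j => (α j : ℤ)) (n - 1)
        ((α (n - 1) : ℤ) - 1)) = 0 := by
      have := hα (n - 1) (by omega)
      unfold staircase at this
      refine aitken_eq_zero_of_neg (k := n - 1) (by omega) ?_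
      rw [Function.update_self]
      omega
    have hsum := sum_aitken_sub_one n (fun k => (α k : ℤ))
    obtain ⟨n', rfl⟩ : ∃ n', n = n' + 1 := ⟨n - 1, by omega⟩
    rw [Nat.add_sub_cancel] at hlast
    rw [Finset.sum_range_succ, hlast, add_zero] at hsum
    funext v
    rw [pow_succ, Module.End.mul_apply]
    nth_rewrite 2 [divDiffSum]
    rw [LinearMap.sum_apply, map_sum, Finset.sum_apply, Nat.add_sub_cancel,
      Finset.sum_congr rfl fun k hk =>
        congrFun (hdiff k (by have := Finset.mem_range.mp hk; omega)) v,
      ← Finset.mul_sum, hsum, Nat.factorial_succ]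
    have hcast : ∑ k ∈ Finset.range (n' + 1), (((α k : ℕ) : ℤ) : ℚ) = m + 1 := by
      exact_mod_cast hdeg
    rw [hcast]
    push_cast
    ring

theorem sum_det_updateRow {ι R : Type*} [Fintype ι] [DecidableEq ι] [CommRing R]
    (A B : Matrix ι ι R) :
    ∑ k, (A.updateRow k (B k)).det = (A.adjugate * B).trace := by
  rw [Matrix.trace_mul_comm, Matrix.trace]
  refine Finset.sum_congr rfl fun k _ => ?_
  rw [← Matrix.cramer_transpose_apply, Matrix.cramer_eq_adjugate_mulVec, Matrix.diag_apply,
    Matrix.mul_apply, ← Matrix.adjugate_transpose]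
  exact Finset.sum_congr rfl fun j _ => mul_comm _ _

/-- The coefficients expressing `∏ t < n, (a - 2 * t) / a!` in terms of reciprocal factorials. -/
def rowCoef : ℕ → ℕ → ℚ
  | 0, 0 => 1
  | 0, _ + 1 => 0
  | n + 1, 0 => rowCoef n 0
  | n + 1, s + 1 => rowCoef n (s + 1) - (n + s) * rowCoef n s

theorem rowCoef_eq_zero_of_lt {n s : ℕ} (h : n < s) : rowCoef n s = 0 := by
  induction n generalizing s with
  | zero =>
    obtain ⟨s, rfl⟩ := Nat.exists_eq_succ_of_ne_zero h.ne'
    simp [rowCoef]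
  | succ n ih =>
    obtain ⟨s, rfl⟩ := Nat.exists_eq_succ_of_ne_zero (by omega : s ≠ 0)
    simp [rowCoef, ih (by omega : n < s), ih (by omega : n < s + 1)]

theorem rowCoef_zero (n : ℕ) : rowCoef n 0 = 1 := by
  induction n with
  | zero => rfl
  | succ n ih => simpa [rowCoef] using ih

theorem rowCoef_one (n : ℕ) : rowCoef n 1 = -(n * (n - 1) / 2) := by
  induction n with
  | zero => simp [rowCoef]
  | succ n ih =>
    simp only [rowCoef, zero_add, ih, rowCoef_zero]
    push_cast
    ring

theorem rowCoef_two (n : ℕ) : rowCoef n 2 = (n + 1) * n * (n - 1) * (n - 2) / 8 := by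
  induction n with
  | zero => simp [rowCoef]
  | succ n ih =>
    simp only [rowCoef, Nat.reduceAdd, ih, rowCoef_one]
    push_cast
    ring

theorem rowCoef_three (n : ℕ) :
    rowCoef n 3 = -((n + 2) * (n + 1) * n * (n - 1) * (n - 2) * (n - 3) / 48) := by
  induction n with
  | zero => simp [rowCoef]
  | succ n ih =>
    simp only [rowCoef, Nat.reduceAdd, ih, rowCoef_two]
    push_cast
    ring

theorem sum_rowCoef_mul_invFact (n : ℕ) (a : ℤ) :
    ∑ s ∈ Finset.range (n + 1), rowCoef n s * invFact (a - n + s) =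
      (∏ t ∈ Finset.range n, ((a : ℚ) - 2 * t)) * invFact a := by
  induction n with
  | zero => simp [rowCoef]
  | succ n ih =>
    rw [Finset.prod_range_succ, mul_right_comm, ← ih, Finset.sum_range_succ', Finset.sum_mul]
    have h1 : ∀ s ∈ Finset.range (n + 1),
        rowCoef (n + 1) (s + 1) * invFact (a - (n + 1 : ℕ) + (s + 1 : ℕ)) =
          rowCoef n (s + 1) * invFact (a - n - 1 + (s + 1 : ℕ)) -
            (n + s) * rowCoef n s * invFact (a - n + s) := by
      intro s _
      rw [rowCoef, sub_mul]
      congr 3 <;> push_cast <;> ring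
    have h2 : ∑ s ∈ Finset.range (n + 1), rowCoef n s * invFact (a - n + s) * (a - 2 * n) =
        ∑ s ∈ Finset.range (n + 1), rowCoef n s * invFact (a - n - 1 + s) -
          ∑ s ∈ Finset.range (n + 1), (n + s) * rowCoef n s * invFact (a - n + s) := by
      rw [← Finset.sum_sub_distrib]
      refine Finset.sum_congr rfl fun s _ => ?_
      have := mul_invFact (a - n + s)
      rw [show a - n - 1 + s = a - n + s - 1 by ring, ← this]
      push_cast
      ring
    have h3 := Finset.sum_range_succ' (fun s : ℕ => rowCoef n s * invFact (a - n - 1 + s)) (n + 1)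
    rw [Finset.sum_range_succ, rowCoef_eq_zero_of_lt (Nat.lt_succ_self n), zero_mul,
      add_zero] at h3
    rw [Finset.sum_congr rfl h1, Finset.sum_sub_distrib, h2, h3, rowCoef]
    push_cast
    rw [show a - (n + 1 : ℤ) + 0 = a - n - 1 + 0 by ring]
    ring

/-- The coefficients expressing the reciprocal factorial of `2 * t - n - r` in terms of those of
`2 * t - n + s` for `1 ≤ s ≤ n`, for every `t < n`. -/
def lowCoef (n : ℕ) : ℕ → ℕ → ℚ
  | 0, s => rowCoef n s
  | r + 1, s => lowCoef n r (s + 1) - (s + r) * lowCoef n r s - lowCoef n r 1 * rowCoef n s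

theorem lowCoef_eq_zero_of_lt {n s : ℕ} (r : ℕ) (h : n < s) : lowCoef n r s = 0 := by
  induction r generalizing s with
  | zero => exact rowCoef_eq_zero_of_lt h
  | succ r ih =>
    simp [lowCoef, ih h, ih (h.trans (Nat.lt_succ_self s)), rowCoef_eq_zero_of_lt h]

theorem invFact_eq_sum_lowCoef {n t : ℕ} (ht : t < n) (r : ℕ) :
    invFact (2 * t - n - r) =
      -∑ s ∈ Finset.range n, lowCoef n r (s + 1) * invFact (2 * t - n + (s + 1 : ℕ)) := by
  have h0 : invFact (2 * t - n) =
      -∑ s ∈ Finset.range n, rowCoef n (s + 1) * invFact (2 * t - n + (s + 1 : ℕ)) := by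
    have := sum_rowCoef_mul_invFact n (2 * t)
    rw [Finset.prod_eq_zero (Finset.mem_range.mpr ht) (by push_cast; ring), zero_mul,
      Finset.sum_range_succ', rowCoef_zero] at this
    push_cast at this ⊢
    rw [add_zero] at this
    linarith
  induction r with
  | zero => simpa [lowCoef] using h0
  | succ r ih =>
    have h1 := mul_invFact (2 * t - n - r)
    have h2 : ∀ s ∈ Finset.range n,
        lowCoef n r (s + 1) * invFact (2 * t - n + (s + 1 : ℕ)) * (2 * t - n - r) =
          lowCoef n r (s + 1) * invFact (2 * t - n + s) -
            ((s + 1 : ℕ) + r) * lowCoef n r (s + 1) * invFact (2 * t - n + (s + 1 : ℕ)) := by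
      intro s _
      have := mul_invFact (2 * t - n + (s + 1 : ℕ))
      rw [show (2 * t - n + (s + 1 : ℕ) - 1 : ℤ) = 2 * t - n + s by push_cast; ring] at this
      rw [← this]
      push_cast
      ring
    have h3 := Finset.sum_range_succ'
      (fun s : ℕ => lowCoef n r (s + 1) * invFact (2 * t - n + s)) n
    rw [Finset.sum_range_succ, lowCoef_eq_zero_of_lt r (Nat.lt_succ_self n), zero_mul,
      add_zero] at h3
    rw [show (2 * t - n - (r + 1 : ℕ) : ℤ) = 2 * t - n - r - 1 by push_cast; ring, ← h1, ih]
    push_cast at h2 h3 h0 ⊢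
    rw [add_zero, h0] at h3
    rw [mul_neg, mul_comm, Finset.sum_mul, Finset.sum_congr rfl h2, Finset.sum_sub_distrib, h3]
    simp only [lowCoef, sub_mul, Finset.sum_sub_distrib]
    rw [mul_neg, Finset.mul_sum]
    push_cast
    simp only [mul_assoc]
    ring

/-- The matrix of column operations turning the Aitken matrix of the staircase into its translate
by three columns. -/
def shiftMatrix (n : ℕ) : Matrix (Fin n) (Fin n) ℚ :=
  Matrix.of fun l j => if (j : ℕ) < 3 then -lowCoef n (2 - j) (l + 1)
    else if (l : ℕ) + 3 = j then 1 else 0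

theorem aitkenMatrix_staircase_mul_shiftMatrix (n : ℕ) :
    aitkenMatrix n (fun k => staircase n k) * shiftMatrix n =
      Matrix.of fun i j : Fin n => invFact ((staircase n i : ℤ) - 3 - (i : ℕ) + (j : ℕ)) := by
  ext i j
  have hi := i.2
  have hj := j.2
  have hst : (staircase n i : ℤ) = n - 1 - (i : ℕ) := by unfold staircase; omega
  rw [Matrix.mul_apply]
  simp only [aitkenMatrix, shiftMatrix, Matrix.of_apply, hst]
  split_ifs with h
  · rw [show (n - 1 - (i : ℕ) - 3 - (i : ℕ) + (j : ℕ) : ℤ) =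
      2 * (n - 1 - i : ℕ) - n - (2 - j : ℕ) by omega, invFact_eq_sum_lowCoef (by omega),
      Finset.sum_range, ← Finset.sum_neg_distrib]
    refine Finset.sum_congr rfl fun l _ => ?_
    rw [mul_neg, mul_comm]
    congr 3
    omega
  · rw [Finset.sum_eq_single ⟨j - 3, by omega⟩]
    · simp only
      rw [if_pos (by omega), mul_one]
      congr 1
      omega
    · intro l _ hl
      rw [if_neg fun h' => hl (Fin.ext (by simp only; omega)), mul_zero]
    · simp

theorem trace_shiftMatrix {n : ℕ} (hn : 3 ≤ n) :
    (shiftMatrix n).trace = -((n * (n - 1) / 2) * (n * (n - 1) / 2 - 1) / 2) := by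
  obtain ⟨m, rfl⟩ := Nat.exists_eq_add_of_le' hn
  rw [Matrix.trace, Fin.sum_univ_succ, Fin.sum_univ_succ, Fin.sum_univ_succ,
    Finset.sum_eq_zero]
  · have h2 : (2 : ℕ) % (m + 3) = 2 := Nat.mod_eq_of_lt (by omega)
    simp [shiftMatrix, lowCoef, rowCoef_one, rowCoef_two, rowCoef_three, h2]
    ring
  · intro l _
    simp [shiftMatrix]

theorem sum_aitken_staircase_sub_three {n : ℕ} (hn : 3 ≤ n) :
    ∑ k ∈ Finset.range n,
        aitken n (Function.update (fun j => (staircase n j : ℤ)) k (staircase n k - 3)) =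
      -((n * (n - 1) / 2) * (n * (n - 1) / 2 - 1) / 2) *
        aitken n (fun j => staircase n j) := by
  rw [Finset.sum_range]
  have h : ∀ k : Fin n,
      aitken n (Function.update (fun j => (staircase n j : ℤ)) k (staircase n k - 3)) =
        ((aitkenMatrix n (fun j => staircase n j)).updateRow k
          ((aitkenMatrix n (fun j => staircase n j) * shiftMatrix n) k)).det := by
    intro k
    rw [aitken, aitken_update k.2, aitkenMatrix_staircase_mul_shiftMatrix]
    rfl
  simp only [h]
  rw [sum_det_updateRow, ← mul_assoc, Matrix.adjugate_mul, Matrix.smul_mul, one_mul,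
    Matrix.trace_smul, trace_shiftMatrix hn, smul_eq_mul, mul_comm, aitken]

/-- The staircase with its entries at `k` and `k + 1` lowered to its entry at `k + 2`. -/
def lowered (n k : ℕ) : ℕ → ℕ :=
  setPair (staircase n) k (staircase n (k + 2)) (staircase n (k + 2))

theorem aitken_lowered {n k : ℕ} (hk : k + 2 < n) :
    aitken n (fun j => lowered n k j) =
      -aitken n (Function.update (fun j => (staircase n j : ℤ)) k (staircase n k - 3)) := by
  have h0 : (staircase n k : ℤ) = staircase n (k + 2) + 2 := by unfold staircase; omega
  have h1 : (staircase n (k + 1) : ℤ) = staircase n (k + 2) + 1 := by unfold staircase; omega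
  simp only [lowered]
  rw [setPair_natCast, aitken_setPair (by omega)]
  congr 2
  funext j
  simp only [setPair, Function.update_apply, h0]
  split_ifs with h2 h3 <;> subst_vars <;> omega

theorem sum_aitken_lowered {n : ℕ} (hn : 3 ≤ n) :
    ∑ k ∈ Finset.range (n - 2), aitken n (fun j => lowered n k j) =
      (n * (n - 1) / 2) * (n * (n - 1) / 2 - 1) / 2 * aitken n (fun j => staircase n j) := by
  have h := sum_aitken_staircase_sub_three hn
  obtain ⟨m, rfl⟩ : ∃ m, n = m + 2 := ⟨n - 2, by omega⟩
  rw [Finset.sum_range_succ, Finset.sum_range_succ,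
    aitken_eq_zero_of_neg (k := m) (by omega), aitken_eq_zero_of_neg (k := m + 1) (by omega)] at h
  · rw [Nat.add_sub_cancel, Finset.sum_congr rfl fun k hk =>
      aitken_lowered (by have := Finset.mem_range.mp hk; omega), Finset.sum_neg_distrib]
    linarith
  · rw [Function.update_self]
    unfold staircase
    omega
  · rw [Function.update_self]
    unfold staircase
    omega

theorem divDiff_braid_mono_staircase {n k : ℕ} (hk : k + 2 < n) :
    divDiff n (k + 1) (divDiff n (k + 2) (divDiff n (k + 1) (mono n (staircase n)))) =
      mono n (lowered n k) := by
  set c := staircase n (k + 2) with hc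
  have h0 : staircase n k = c + 1 + 1 := by unfold staircase at *; omega
  have h1 : staircase n (k + 1) = c + 1 := by unfold staircase at *; omega
  have e1 : staircase n = setPair (staircase n) k (c + 1 + 1) (c + 1) := by
    rw [← h0, ← h1, setPair_self]
  have e2 : setPair (staircase n) k (c + 1) (c + 1) =
      setPair (setPair (staircase n) k (c + 1) (c + 1)) (k + 1) (c + 1) c := by
    funext j
    simp only [setPair, Function.update_apply]
    split_ifs <;> subst_vars <;> first | rfl | omega
  have e3 : setPair (setPair (staircase n) k (c + 1) (c + 1)) (k + 1) c c =
      setPair (staircase n) k (c + 1) c := by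
    funext j
    simp only [setPair, Function.update_apply]
    split_ifs <;> subst_vars <;> first | rfl | omega
  have d1 := divDiff_mono (show k + 1 < n by omega) (staircase n) (c + 1) 1
  have d2 := divDiff_mono hk (setPair (staircase n) k (c + 1) (c + 1)) c 1
  have d3 := divDiff_mono (show k + 1 < n by omega) (staircase n) c 1
  simp only [Finset.sum_range_one, Nat.sub_self, add_zero] at d1 d2 d3
  rw [← e1] at d1
  rw [← e2, e3] at d2
  rw [d1, d2, d3, lowered]

theorem divDiff_braid_mono_staircase' {n k : ℕ} (hk : k + 2 < n) :
    divDiff n (k + 2) (divDiff n (k + 1) (divDiff n (k + 2) (mono n (staircase n)))) =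
      mono n (lowered n k) := by
  set c := staircase n (k + 2) with hc
  have h0 : staircase n k = c + 2 := by unfold staircase at *; omega
  have h1 : staircase n (k + 1) = c + 1 := by unfold staircase at *; omega
  have e1 : staircase n = setPair (staircase n) (k + 1) (c + 1) c := by
    rw [← h1, hc, setPair_self]
  have e2 : setPair (staircase n) (k + 1) c c = setPair (staircase n) k (c + 2) c := by
    funext j
    simp only [setPair, Function.update_apply]
    split_ifs <;> subst_vars <;> first | rfl | omega
  have e3 : setPair (staircase n) k c (c + 1) =
      setPair (setPair (staircase n) k c (c + 1)) (k + 1) (c + 1) c := by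
    funext j
    simp only [setPair, Function.update_apply]
    split_ifs <;> subst_vars <;> first | rfl | omega
  have e4 : setPair (setPair (staircase n) k c (c + 1)) (k + 1) c c = lowered n k := by
    funext j
    simp only [lowered, setPair, Function.update_apply]
    split_ifs <;> subst_vars <;> rfl
  have e5 : setPair (staircase n) k (c + 1) c =
      setPair (setPair (staircase n) k (c + 1) c) (k + 1) c c := by
    funext j
    simp only [setPair, Function.update_apply]
    split_ifs <;> subst_vars <;> first | rfl | omega
  have d1 := divDiff_mono hk (staircase n) c 1
  have d2 := divDiff_mono (show k + 1 < n by omega) (staircase n) c 2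
  have d3 := divDiff_mono hk (setPair (staircase n) k c (c + 1)) c 1
  have d4 := divDiff_mono hk (setPair (staircase n) k (c + 1) c) c 0
  simp only [Finset.sum_range_succ, Finset.sum_range_zero, zero_add, Nat.sub_self, Nat.sub_zero,
    Nat.add_one_sub_one, add_zero] at d1 d2 d3 d4
  rw [← e1] at d1
  rw [← e3, e4] at d3
  rw [← e5] at d4
  rw [d1, e2, d2, map_add, d3, d4, add_zero]

/-- The words of length `m` in the letters `1, …, n - 1`. -/
def words (n : ℕ) : ℕ → Finset (List ℕ)
  | 0 => {[]}
  | m + 1 => (words n m ×ˢ Finset.range (n - 1)).image fun x => x.1 ++ [x.2 + 1]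

theorem sum_words_succ {M : Type*} [AddCommMonoid M] (n m : ℕ) (f : List ℕ → M) :
    ∑ l ∈ words n (m + 1), f l =
      ∑ l ∈ words n m, ∑ a ∈ Finset.range (n - 1), f (l ++ [a + 1]) := by
  rw [words, Finset.sum_image, Finset.sum_product]
  rintro ⟨l, a⟩ _ ⟨l', a'⟩ _ h
  simpa [List.append_inj_left'] using List.append_inj' h rfl

theorem mem_words {n m : ℕ} {l : List ℕ} :
    l ∈ words n m ↔ (∀ i ∈ l, 1 ≤ i ∧ i ≤ n - 1) ∧ l.length = m := by
  induction m generalizing l with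
  | zero =>
    rw [words, Finset.mem_singleton, List.length_eq_zero_iff]
    exact ⟨by rintro rfl; simp, fun h => h.2⟩
  | succ m ih =>
    simp only [words, Finset.mem_image, Finset.mem_product, Prod.exists, ih, Finset.mem_range]
    constructor
    · rintro ⟨l, a, ⟨⟨h1, rfl⟩, ha⟩, rfl⟩
      refine ⟨fun i hi => ?_, by simp⟩
      rcases List.mem_append.mp hi with hi | hi
      · exact h1 i hi
      · rw [List.mem_singleton] at hi
        omega
    · rintro ⟨h1, h2⟩
      rcases List.eq_nil_or_concat' l with rfl | ⟨l, a, rfl⟩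
      · simp at h2
      · have ha := h1 a (by simp)
        refine ⟨l, a - 1, ⟨⟨fun i hi => h1 i (by simp [hi]), by simpa using h2⟩, by omega⟩, ?_⟩
        rw [Nat.sub_add_cancel ha.1]

theorem sum_divDiffWord (n m : ℕ) : ∑ l ∈ words n m, divDiffWord n l = divDiffSum n ^ m := by
  induction m with
  | zero => simp [words, divDiffWord]
  | succ m ih =>
    rw [sum_words_succ, pow_succ, ← ih, divDiffSum, Finset.sum_mul]
    refine Finset.sum_congr rfl fun l _ => ?_
    rw [Finset.mul_sum]
    refine Finset.sum_congr rfl fun a _ => ?_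
    simp [divDiffWord]

/-- The length of the longest element. -/
def topLength (n : ℕ) : ℕ := ∑ k ∈ Finset.range n, staircase n k

theorem topLength_cast (n : ℕ) : (topLength n : ℚ) = n * (n - 1) / 2 := by
  have h : topLength n * 2 = n * (n - 1) := by
    rw [topLength, ← Finset.sum_range_id_mul_two, ← Finset.sum_range_reflect fun k => k]
    rfl
  cases n with
  | zero => simp [topLength]
  | succ n =>
    have h' : ((topLength (n + 1) : ℕ) : ℚ) * 2 = ((n + 1 : ℕ) : ℚ) * n := by exact_mod_cast h
    push_cast at h' ⊢
    linarith

/-- The reduced words of the longest element. -/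
def topWords (n : ℕ) : Finset (List ℕ) :=
  (words n (topLength n)).filter fun l => wordProd n l = w₀ n

theorem isReducedWordFor_w₀_iff {n : ℕ} {l : List ℕ} :
    IsReducedWordFor n (w₀ n) l ↔ l ∈ topWords n := by
  have hlow : ∀ l', IsWordFor n (w₀ n) l' → topLength n ≤ l'.length := by
    intro l' h
    have := noninv_le_length l' h.1 1 (by rw [one_mul, h.2])
    rwa [noninv_one] at this
  rw [topWords, Finset.mem_filter, mem_words]
  constructor
  · intro h
    obtain ⟨l', h1, h2, h3⟩ := exists_word_to_w₀ (1 : Equiv.Perm (Fin n))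
    have hle := h.2 l' ⟨h1, by rwa [one_mul] at h2⟩
    rw [h3, noninv_one] at hle
    exact ⟨⟨h.1.1, le_antisymm hle (hlow l h.1)⟩, h.1.2⟩
  · rintro ⟨⟨h1, h2⟩, h3⟩
    exact ⟨⟨h1, h3⟩, fun l' h' => h2 ▸ hlow l' h'⟩

theorem topConst_mul_card_filter (n : ℕ) (p : List ℕ → Prop) :
    topConst n * ((topWords n).filter p).card =
      ∑ l ∈ words n (topLength n),
        if p l then divDiffWord n l (mono n (staircase n)) 1 else 0 := by
  rw [Finset.card_eq_sum_ones, topWords, Finset.filter_filter, Finset.sum_filter]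
  push_cast
  rw [Finset.mul_sum]
  refine Finset.sum_congr rfl fun l hl => ?_
  obtain ⟨h1, h2⟩ := mem_words.mp hl
  rw [divDiffWord_mono_staircase l h1 h2]
  split_ifs <;> simp_all

theorem topConst_mul_card {n : ℕ} (hn : 1 ≤ n) :
    topConst n * (topWords n).card =
      (topLength n).factorial * aitken n (fun k => staircase n k) := by
  have h := topConst_mul_card_filter n fun _ => True
  simp only [Finset.filter_true, if_true] at h
  rw [h, ← Finset.sum_apply, ← LinearMap.sum_apply, sum_divDiffWord,
    divDiffSum_pow_mono (m := topLength n) hn _ (fun _ _ => le_rfl) rfl]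

/-- The word `l` supports a long braid move at the zero-based position `k`. -/
def BraidAt (l : List ℕ) (k : ℕ) : Prop :=
  ∃ i : ℕ, (l.getD k 0, l.getD (k + 1) 0, l.getD (k + 2) 0) = (i, i + 1, i) ∨
    (l.getD k 0, l.getD (k + 1) 0, l.getD (k + 2) 0) = (i + 1, i, i + 1)

theorem braidAt_append {l : List ℕ} {m : ℕ} (hl : l.length = m) (a b c : ℕ) :
    BraidAt (l ++ [a + 1] ++ [b + 1] ++ [c + 1]) m ↔ a = c ∧ (b = a + 1 ∨ a = b + 1) := by
  subst hl
  unfold BraidAt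
  simp only [List.append_assoc, List.cons_append, List.nil_append, List.getD_eq_getElem?_getD,
    List.getElem?_append_right le_rfl, List.getElem?_append_right (Nat.le_add_right _ _),
    Nat.sub_self, Nat.add_sub_cancel_left, List.getElem?_cons_zero, List.getElem?_cons_succ,
    Option.getD_some, Prod.mk.injEq]
  constructor
  · rintro ⟨i, h | h⟩ <;> omega
  · rintro ⟨h1, h2 | h2⟩
    · exact ⟨a + 1, by omega⟩
    · exact ⟨b + 1, by omega⟩

theorem simpleRefl_mul_w₀ {n i : ℕ} (hi : 1 ≤ i ∧ i ≤ n - 1) :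
    simpleRefl n i * w₀ n = w₀ n * simpleRefl n (n - i) := by
  rw [simpleRefl_eq (by omega), simpleRefl_eq (by omega), Equiv.mul_swap_eq_swap_mul,
    Equiv.swap_comm]
  congr 2 <;> ext <;> simp only [w₀, Fin.revPerm_apply, Fin.val_rev] <;> omega

/-- Move the first letter of a word to the end, conjugating it by the longest element. -/
def rotate (n : ℕ) : List ℕ → List ℕ
  | [] => []
  | i :: t => t ++ [n - i]

theorem rotate_mem_topWords {n : ℕ} {l : List ℕ} (h : l ∈ topWords n) :
    rotate n l ∈ topWords n := by
  cases l with
  | nil => exact h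
  | cons i t =>
    simp only [topWords, Finset.mem_filter, mem_words, rotate] at h ⊢
    obtain ⟨⟨h1, h2⟩, h3⟩ := h
    have hi := h1 i (by simp)
    refine ⟨⟨fun j hj => ?_, by simpa using h2⟩, ?_⟩
    · rcases List.mem_append.mp hj with hj | hj
      · exact h1 j (by simp [hj])
      · rw [List.mem_singleton] at hj
        omega
    · have h4 : simpleRefl n i * wordProd n t = w₀ n := by simpa [wordProd] using h3
      have h5 : wordProd n t = simpleRefl n i * w₀ n := by
        rw [← h4, ← mul_assoc, simpleRefl_mul_self, one_mul]
      have h6 : wordProd n (t ++ [n - i]) = wordProd n t * simpleRefl n (n - i) := by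
        simp [wordProd]
      rw [h6, h5, simpleRefl_mul_w₀ hi, mul_assoc, simpleRefl_mul_self, mul_one]

theorem rotate_injOn (n : ℕ) : Set.InjOn (rotate n) (topWords n) := by
  intro l hl l' hl' h
  simp only [topWords, Finset.coe_filter, Set.mem_ofPred_eq, mem_words] at hl hl'
  have hlen : l.length = l'.length := hl.1.2.trans hl'.1.2.symm
  cases l with
  | nil => exact (List.length_eq_zero_iff.mp hlen.symm).symm
  | cons i t =>
    cases l' with
    | nil => simp at hlen
    | cons i' t' =>
      have hi := hl.1.1 i (by simp)
      have hi' := hl'.1.1 i' (by simp)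
      obtain ⟨h1, h2⟩ := List.append_inj' h rfl
      rw [List.singleton_inj] at h2
      rw [h1, show i = i' by omega]

theorem image_rotate (n : ℕ) : (topWords n).image (rotate n) = topWords n :=
  Finset.eq_of_subset_of_card_le (Finset.image_subset_iff.mpr fun _ => rotate_mem_topWords)
    (Finset.card_image_of_injOn (rotate_injOn n)).ge

theorem braidAt_rotate {n k : ℕ} {l : List ℕ} (h : k + 3 < l.length) :
    BraidAt (rotate n l) k ↔ BraidAt l (k + 1) := by
  cases l with
  | nil => simp at h
  | cons i t =>
    rw [List.length_cons] at h
    simp only [BraidAt, rotate, List.getD_cons_succ]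
    rw [List.getD_append _ _ _ _ (by omega), List.getD_append _ _ _ _ (by omega),
      List.getD_append _ _ _ _ (by omega)]

theorem card_braidAt_succ {n k : ℕ} (h : k + 3 < topLength n) :
    ((topWords n).filter fun l => BraidAt l (k + 1)).card =
      ((topWords n).filter fun l => BraidAt l k).card := by
  conv_rhs => rw [← image_rotate, Finset.filter_image]
  rw [Finset.card_image_of_injOn ((rotate_injOn n).mono (Finset.coe_subset.mpr (Finset.filter_subset _ _)))]
  congr 1
  refine Finset.filter_congr fun l hl => (braidAt_rotate ?_).symm
  rwa [(mem_words.mp (Finset.mem_filter.mp hl).1).2]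

theorem sum_braidCount {n m : ℕ} (hm : topLength n = m + 3) :
    ∑ l ∈ topWords n, braidCount l =
      (m + 1) * ((topWords n).filter fun l => BraidAt l m).card := by
  have hconst : ∀ k ≤ m, ((topWords n).filter fun l => BraidAt l k).card =
      ((topWords n).filter fun l => BraidAt l m).card := by
    intro k hk
    induction hk using Nat.decreasingInduction with
    | self => rfl
    | of_succ k hk ih => rw [← ih, card_braidAt_succ (by omega)]
  have h : ∀ l ∈ topWords n, braidCount l =
      ∑ k ∈ Finset.range (m + 1), if BraidAt l k then 1 else 0 := by
    intro l hl
    rw [← Finset.card_filter, braidCount, (mem_words.mp (Finset.mem_filter.mp hl).1).2, hm]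
    rfl
  rw [Finset.sum_congr rfl h, Finset.sum_comm]
  simp only [← Finset.card_filter]
  rw [Finset.sum_congr rfl fun k hk => hconst k (by have := Finset.mem_range.mp hk; omega)]
  simp

theorem sum_sum_ite_succ {M : Type*} [AddCommMonoid M] (N : ℕ) (f : ℕ → ℕ → M) :
    ∑ a ∈ Finset.range (N + 1), ∑ b ∈ Finset.range (N + 1), (if b = a + 1 then f a b else 0) =
      ∑ k ∈ Finset.range N, f k (k + 1) := by
  simp only [Finset.sum_ite_eq', Finset.mem_range]
  rw [Finset.sum_range_succ, if_neg (lt_irrefl _), add_zero]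
  exact Finset.sum_congr rfl fun k hk => by
    rw [if_pos (by have := Finset.mem_range.mp hk; omega)]

theorem sum_ite_braid {M : Type*} [AddCommMonoid M] (N : ℕ) (f : ℕ → ℕ → ℕ → M) :
    ∑ a ∈ Finset.range (N + 1), ∑ b ∈ Finset.range (N + 1), ∑ c ∈ Finset.range (N + 1),
        (if a = c ∧ (b = a + 1 ∨ a = b + 1) then f a b c else 0) =
      ∑ k ∈ Finset.range N, (f k (k + 1) k + f (k + 1) k (k + 1)) := by
  rw [Finset.sum_add_distrib, ← sum_sum_ite_succ N fun a b => f a b a,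
    ← sum_sum_ite_succ N fun a b => f b a b,
    Finset.sum_comm (f := fun a b => if b = a + 1 then f b a b else 0), ← Finset.sum_add_distrib]
  refine Finset.sum_congr rfl fun a ha => ?_
  rw [← Finset.sum_add_distrib]
  refine Finset.sum_congr rfl fun b _ => ?_
  simp only [ite_and, Finset.sum_ite_eq, if_pos ha]
  split_ifs <;> first | omega | simp

theorem topConst_mul_card_braidAt {n m : ℕ} (hn : 3 ≤ n) (hm : topLength n = m + 3) :
    topConst n * ((topWords n).filter fun l => BraidAt l m).card =
      ∑ k ∈ Finset.range (n - 2), 2 * (m.factorial * aitken n fun j => lowered n k j) := by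
  rw [topConst_mul_card_filter, hm]
  simp only [sum_words_succ]
  have h1 : ∀ l ∈ words n m, ∀ a b c,
      (if BraidAt (l ++ [a + 1] ++ [b + 1] ++ [c + 1]) m then
        divDiffWord n (l ++ [a + 1] ++ [b + 1] ++ [c + 1]) (mono n (staircase n)) 1 else 0) =
      if a = c ∧ (b = a + 1 ∨ a = b + 1) then divDiffWord n l (divDiff n (a + 1)
        (divDiff n (b + 1) (divDiff n (c + 1) (mono n (staircase n))))) 1 else 0 := by
    intro l hl a b c
    rw [divDiffWord_append, divDiffWord_append, divDiffWord_append]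
    simp only [braidAt_append (mem_words.mp hl).2]
    simp [divDiffWord]
  obtain ⟨N, rfl⟩ : ∃ N, n = N + 2 := ⟨n - 2, by omega⟩
  rw [Finset.sum_congr rfl fun l hl => Finset.sum_congr rfl fun a _ => Finset.sum_congr rfl
    fun b _ => Finset.sum_congr rfl fun c _ => h1 l hl a b c]
  simp only [show N + 2 - 1 = N + 1 from rfl, Nat.add_sub_cancel, sum_ite_braid]
  rw [Finset.sum_comm]
  refine Finset.sum_congr rfl fun k hk => ?_
  have hk' : k + 2 < N + 2 := by have := Finset.mem_range.mp hk; omega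
  rw [Finset.sum_congr rfl fun l _ => by
    rw [divDiff_braid_mono_staircase hk', divDiff_braid_mono_staircase' hk', ← two_mul],
    ← Finset.mul_sum, ← Finset.sum_apply, ← LinearMap.sum_apply, sum_divDiffWord,
    divDiffSum_pow_mono (by omega)]
  · intro j _
    simp only [lowered, setPair, Function.update_apply]
    unfold staircase
    split_ifs <;> omega
  · have h2 := sum_setPair (show k + 1 < N + 2 by omega) (staircase (N + 2))
      (staircase (N + 2) (k + 2)) (staircase (N + 2) (k + 2))
    have h3 : topLength (N + 2) = ∑ j ∈ Finset.range (N + 2), staircase (N + 2) j := rfl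
    have h4 : staircase (N + 2) k = staircase (N + 2) (k + 2) + 2 := by unfold staircase; omega
    have h5 : staircase (N + 2) (k + 1) = staircase (N + 2) (k + 2) + 1 := by
      unfold staircase; omega
    unfold lowered
    omega

theorem sum_braidCount_topWords {n : ℕ} (hn : 3 ≤ n) :
    ∑ l ∈ topWords n, braidCount l = (topWords n).card := by
  have hL := topLength_cast n
  obtain ⟨m, hm⟩ : ∃ m, topLength n = m + 3 := by
    refine Nat.exists_eq_add_of_le' ?_
    have h3 : (3 : ℚ) ≤ n := by exact_mod_cast hn
    have : (3 : ℚ) ≤ topLength n := by rw [hL]; nlinarith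
    exact_mod_cast this
  rw [sum_braidCount hm]
  have h1 := topConst_mul_card (show 1 ≤ n by omega)
  have h2 := topConst_mul_card_braidAt hn hm
  rw [← Finset.mul_sum, ← Finset.mul_sum, sum_aitken_lowered hn, ← hL, hm] at h2
  rw [hm, Nat.factorial_succ, Nat.factorial_succ, Nat.factorial_succ] at h1
  have : topConst n * (((m + 1) * ((topWords n).filter fun l => BraidAt l m).card : ℕ) : ℚ) =
      topConst n * (topWords n).card := by
    push_cast at h1 h2 ⊢
    rw [mul_left_comm, h2, h1]
    ring
  exact_mod_cast mul_left_cancel₀ (topConst_ne_zero n) this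

/-- Reiner's theorem: for `n ≥ 3`, the expected number of long braid moves in a reduced
word for `w₀ ∈ S_n` is `1`; equivalently, the number of pairs (reduced word, position
supporting a long braid move) equals the number of reduced words for `w₀`. -/
theorem expected_long_braid_moves (n : ℕ) (hn : 3 ≤ n) :
    (∑ᶠ l ∈ {l : List ℕ | IsReducedWordFor n (w₀ n) l}, braidCount l) =
      Nat.card {l : List ℕ // IsReducedWordFor n (w₀ n) l} := by
  have h : {l : List ℕ | IsReducedWordFor n (w₀ n) l} = topWords n :=
    Set.ext fun l => isReducedWordFor_w₀_iff
  rw [h, finsum_mem_coe_finset, sum_braidCount_topWords hn, ← Set.ncard_coe_finset, ← h]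
  rfl
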